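/- Let p > 1/3 and let ε > 0 be a constant with ε < min{1−p, (3p−1)/2}, and set s_min = √n/ε². For the 3-Majority dynamics with uniform noise probability p, for any starting configuration with s_0 ≥ s_min and all sufficiently large n, with probability at least 1 − 1/n there exists a time τ ≤ 4·(log n)/ε such that |s_τ| ≤ s_min. -/

import Mathlib

/-- The probability that a fixed node adopts opinion `beta` in one round of the
`3-Majority` dynamics with uniform communication noise probability `p`, on the complete
graph on `n` nodes, given that the current bias (#beta − #alpha) is `s`.
With `b' = ((n+s)/(2n))·(1−p) + p/2` and `a' = ((n−s)/(2n))·(1−p) + p/2`, it equals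
`b'^3 + 3·a'·b'^2`. -/
noncomputable def qStep (n : ℕ) (p : ℝ) (s : ℤ) : ℝ :=
  ((((n : ℝ) + (s : ℝ)) / (2 * (n : ℝ))) * (1 - p) + p / 2) ^ 3 +
    3 * ((((n : ℝ) - (s : ℝ)) / (2 * (n : ℝ))) * (1 - p) + p / 2) *
      ((((n : ℝ) + (s : ℝ)) / (2 * (n : ℝ))) * (1 - p) + p / 2) ^ 2

/-- Probability that `b_t = k` (i.e. exactly `k` nodes adopt beta), given `s_{t-1} = s`:
the binomial distribution `Binomial(n, qStep n p s)`. -/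
noncomputable def binomProb (n : ℕ) (p : ℝ) (s : ℤ) (k : ℕ) : ℝ :=
  (n.choose k : ℝ) * qStep n p s ^ k * (1 - qStep n p s) ^ (n - k)

open scoped Classical in
/-- One-step probability of the event `A` for the new bias `s_t = 2·b_t − n`,
conditional on `s_{t-1} = s`. -/
noncomputable def stepProb (n : ℕ) (p : ℝ) (s : ℤ) (A : ℤ → Prop) : ℝ :=
  ∑ k ∈ Finset.range (n + 1), if A (2 * (k : ℤ) - (n : ℤ)) then binomProb n p s k else 0

/-- One-step expectation of `f (s_t)` conditional on `s_{t-1} = s`. -/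
noncomputable def stepExp (n : ℕ) (p : ℝ) (s : ℤ) (f : ℤ → ℝ) : ℝ :=
  ∑ k ∈ Finset.range (n + 1), binomProb n p s k * f (2 * (k : ℤ) - (n : ℤ))

/-- The equilibrium bias `s_eq = (n/(1−p))·√((1−3p)/(1−p))`. -/
noncomputable def sEq (n : ℕ) (p : ℝ) : ℝ :=
  ((n : ℝ) / (1 - p)) * Real.sqrt ((1 - 3 * p) / (1 - p))

/-- Bias trajectory: `ω t` records the number of beta-nodes at round `t+1`;
the bias at time `0` is `s0` and at time `t+1` it is `2·(ω t) − n`. -/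
def biasAt (n : ℕ) (s0 : ℤ) (ω : ℕ → Fin (n + 1)) : ℕ → ℤ
  | 0 => s0
  | t + 1 => 2 * ((ω t).val : ℤ) - (n : ℤ)

/-- Probability of the first `t` steps of the trajectory `ω` of the Markov chain started
at bias `s0` (product of one-step binomial probabilities). -/
noncomputable def trajP (n : ℕ) (p : ℝ) (s0 : ℤ) (ω : ℕ → Fin (n + 1)) : ℕ → ℝ
  | 0 => 1
  | t + 1 => trajP n p s0 ω t * binomProb n p (biasAt n s0 ω t) (ω t).val

/-- Extend a finite path to an infinite one (junk after time `T`). -/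
def extendPath (n T : ℕ) (ω : Fin T → Fin (n + 1)) : ℕ → Fin (n + 1) :=
  fun t => if h : t < T then ω ⟨t, h⟩ else 0

open scoped Classical in
/-- Probability that the bias trajectory `(s_0, s_1, …, s_T)` of the 3-Majority Markov
chain with noise `p`, started from `s_0 = s0`, satisfies the event `E`. -/
noncomputable def trajProb (n : ℕ) (p : ℝ) (s0 : ℤ) (T : ℕ) (E : (ℕ → ℤ) → Prop) : ℝ :=
  ∑ ω : Fin T → Fin (n + 1),
    if E (biasAt n s0 (extendPath n T ω)) then trajP n p s0 (extendPath n T ω) T else 0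

lemma biasAt_shift (n : ℕ) (s0 : ℤ) (ω : ℕ → Fin (n + 1)) (t : ℕ) :
    biasAt n s0 ω (t + 1) =
      biasAt n (2 * ((ω 0).val : ℤ) - (n : ℤ)) (fun i => ω (i + 1)) t := by
  cases t <;> rfl

lemma trajP_shift (n : ℕ) (p : ℝ) (s0 : ℤ) (ω : ℕ → Fin (n + 1)) (t : ℕ) :
    trajP n p s0 ω (t + 1) = binomProb n p s0 (ω 0).val *
      trajP n p (2 * ((ω 0).val : ℤ) - (n : ℤ)) (fun i => ω (i + 1)) t := by
  induction t with
  | zero => simp [trajP, biasAt]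
  | succ t ih =>
    rw [trajP, ih, biasAt_shift, trajP]
    ring

lemma extendPath_cons_zero (n T : ℕ) (k : Fin (n + 1)) (ω : Fin T → Fin (n + 1)) :
    extendPath n (T + 1) (Fin.cons k ω) 0 = k := by
  simp [extendPath]

lemma extendPath_cons_succ (n T : ℕ) (k : Fin (n + 1)) (ω : Fin T → Fin (n + 1)) :
    (fun i => extendPath n (T + 1) (Fin.cons k ω) (i + 1)) = extendPath n T ω := by
  funext i
  by_cases h : i < T
  · unfold extendPath
    rw [dif_pos h, dif_pos (Nat.succ_lt_succ h)]
    exact Fin.cons_succ (α := fun _ => Fin (n + 1)) k ω ⟨i, h⟩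
  · simp [extendPath, h]

/-- Prepend a state to a trajectory. -/
def consState (s : ℤ) (σ : ℕ → ℤ) : ℕ → ℤ
  | 0 => s
  | t + 1 => σ t

lemma biasAt_cons (n T : ℕ) (s : ℤ) (k : Fin (n + 1)) (ω : Fin T → Fin (n + 1)) :
    biasAt n s (extendPath n (T + 1) (Fin.cons k ω)) =
      consState s (biasAt n (2 * (k.val : ℤ) - (n : ℤ)) (extendPath n T ω)) := by
  funext t
  cases t with
  | zero => rfl
  | succ t =>
    rw [biasAt_shift, extendPath_cons_zero, extendPath_cons_succ]
    rfl

lemma trajProb_succ (n : ℕ) (p : ℝ) (s : ℤ) (T : ℕ) (E : (ℕ → ℤ) → Prop) :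
    trajProb n p s (T + 1) E = ∑ k : Fin (n + 1), binomProb n p s k.val *
      trajProb n p (2 * (k.val : ℤ) - (n : ℤ)) T (fun σ => E (consState s σ)) := by
  classical
  unfold trajProb
  rw [← (Fin.consEquiv (fun _ : Fin (T + 1) => Fin (n + 1))).sum_comp, Fintype.sum_prod_type]
  refine Finset.sum_congr rfl fun k _ => ?_
  rw [Finset.mul_sum]
  refine Finset.sum_congr rfl fun ω _ => ?_
  have h : (Fin.consEquiv (fun _ : Fin (T + 1) => Fin (n + 1))) (k, ω) = Fin.cons k ω := rfl
  rw [h, biasAt_cons, trajP_shift, extendPath_cons_zero, extendPath_cons_succ]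
  split_ifs <;> simp

lemma trajProb_zero_true (n : ℕ) (p : ℝ) (s : ℤ) :
    trajProb n p s 0 (fun _ => True) = 1 := by
  simp [trajProb, trajP]

lemma binom_sum (n : ℕ) (p : ℝ) (s : ℤ) :
    ∑ k : Fin (n + 1), binomProb n p s k.val = 1 := by
  rw [Fin.sum_univ_eq_sum_range (fun k => binomProb n p s k) (n + 1)]
  have h := congrArg (Polynomial.eval (qStep n p s)) (bernsteinPolynomial.sum ℝ n)
  simpa [Polynomial.eval_finsetSum, bernsteinPolynomial, binomProb] using h

lemma binom_second (n : ℕ) (p : ℝ) (s : ℤ) :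
    ∑ k : Fin (n + 1), binomProb n p s k.val * (((2 * (k.val : ℤ) - (n : ℤ) : ℤ) : ℝ)) ^ 2 =
      4 * n * qStep n p s * (1 - qStep n p s) + (n * (2 * qStep n p s - 1)) ^ 2 := by
  rw [Fin.sum_univ_eq_sum_range
    (fun k => binomProb n p s k * (((2 * (k : ℤ) - (n : ℤ) : ℤ) : ℝ)) ^ 2) (n + 1)]
  set q := qStep n p s with hq
  have h0 : ∑ k ∈ Finset.range (n + 1), binomProb n p s k = 1 := by
    have h := congrArg (Polynomial.eval q) (bernsteinPolynomial.sum ℝ n)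
    simpa [Polynomial.eval_finsetSum, bernsteinPolynomial, binomProb] using h
  have h1 : ∑ k ∈ Finset.range (n + 1), (k : ℝ) * binomProb n p s k = n * q := by
    have h := congrArg (Polynomial.eval q) (bernsteinPolynomial.sum_smul ℝ n)
    simpa [Polynomial.eval_finsetSum, bernsteinPolynomial, binomProb, nsmul_eq_mul] using h
  have h2 : ∑ k ∈ Finset.range (n + 1), (n * q - k) ^ 2 * binomProb n p s k
      = n * q * (1 - q) := by
    have h := congrArg (Polynomial.eval q) (bernsteinPolynomial.variance ℝ n)
    simpa [Polynomial.eval_finsetSum, bernsteinPolynomial, binomProb, nsmul_eq_mul] using h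
  have e : ∀ k ∈ Finset.range (n + 1),
      binomProb n p s k * (((2 * (k : ℤ) - (n : ℤ) : ℤ) : ℝ)) ^ 2 =
      ((n * (2 * q - 1)) ^ 2 - 4 * (n * (2 * q - 1)) * (n * q)) * binomProb n p s k
      + (4 * (n * (2 * q - 1))) * ((k : ℝ) * binomProb n p s k)
      + 4 * ((n * q - k) ^ 2 * binomProb n p s k) := by
    intro k _
    push_cast
    ring
  rw [Finset.sum_congr rfl e, Finset.sum_add_distrib, Finset.sum_add_distrib,
    ← Finset.mul_sum, ← Finset.mul_sum, ← Finset.mul_sum, h0, h1, h2]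
  ring

lemma qStep_eq (n : ℕ) (hn : 0 < n) (p : ℝ) (s : ℤ) :
    qStep n p s = (1 + (3 * ((1 - p) * (s / n)) - ((1 - p) * (s / n)) ^ 3) / 2) / 2 := by
  have : (n : ℝ) ≠ 0 := by positivity
  unfold qStep
  field_simp
  ring

lemma y_bound (n : ℕ) (hn : 0 < n) (p : ℝ) (hp0 : 0 ≤ p) (hp : p ≤ 1) (s : ℤ)
    (hs : |s| ≤ (n : ℤ)) : |(1 - p) * ((s : ℝ) / n)| ≤ 1 := by
  have hn' : (0 : ℝ) < n := by exact_mod_cast hn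
  have h : |(s : ℝ)| ≤ n := by exact_mod_cast hs
  rw [abs_mul, abs_div, abs_of_nonneg (by linarith : 0 ≤ 1 - p), abs_of_pos hn']
  have : |(s : ℝ)| / n ≤ 1 := by rw [div_le_one hn']; exact h
  exact mul_le_one₀ (by linarith) (by positivity) this

lemma qStep_mem (n : ℕ) (hn : 0 < n) (p : ℝ) (hp0 : 0 ≤ p) (hp : p ≤ 1) (s : ℤ)
    (hs : |s| ≤ (n : ℤ)) : 0 ≤ qStep n p s ∧ qStep n p s ≤ 1 := by
  have h := abs_le.1 (y_bound n hn p hp0 hp s hs)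
  rw [qStep_eq n hn]
  set y := (1 - p) * ((s : ℝ) / n)
  constructor
  · nlinarith [mul_nonneg (sq_nonneg (y + 1)) (by linarith : 0 ≤ 2 - y)]
  · nlinarith [mul_nonneg (sq_nonneg (y - 1)) (by linarith : 0 ≤ 2 + y)]

lemma binomProb_nonneg (n : ℕ) (hn : 0 < n) (p : ℝ) (hp0 : 0 ≤ p) (hp : p ≤ 1) (s : ℤ)
    (hs : |s| ≤ (n : ℤ)) (k : ℕ) : 0 ≤ binomProb n p s k := by
  obtain ⟨h0, h1⟩ := qStep_mem n hn p hp0 hp s hs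
  have : 0 ≤ 1 - qStep n p s := by linarith
  unfold binomProb
  positivity

lemma next_bound (n : ℕ) (k : Fin (n + 1)) : |2 * (k.val : ℤ) - (n : ℤ)| ≤ (n : ℤ) := by
  have := k.isLt
  rw [abs_le]
  constructor <;> omega

lemma trajProb_true (n : ℕ) (p : ℝ) (T : ℕ) : ∀ s : ℤ,
    trajProb n p s T (fun _ => True) = 1 := by
  induction T with
  | zero => exact trajProb_zero_true n p
  | succ T ih =>
    intro s
    rw [trajProb_succ]
    simp only [ih, mul_one]
    exact binom_sum n p s

lemma trajProb_mono (n : ℕ) (hn : 0 < n) (p : ℝ) (hp0 : 0 ≤ p) (hp : p ≤ 1) (T : ℕ) :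
    ∀ s : ℤ, |s| ≤ (n : ℤ) → ∀ E F : (ℕ → ℤ) → Prop, (∀ σ, E σ → F σ) →
      trajProb n p s T E ≤ trajProb n p s T F := by
  induction T with
  | zero =>
    intro s _ E F h
    unfold trajProb
    refine Finset.sum_le_sum fun ω _ => ?_
    simp only [trajP]
    split_ifs with h1 h2
    · exact le_rfl
    · exact absurd (h _ h1) h2
    · exact zero_le_one
    · exact le_rfl
  | succ T ih =>
    intro s hs E F h
    rw [trajProb_succ, trajProb_succ]
    refine Finset.sum_le_sum fun k _ => ?_
    exact mul_le_mul_of_nonneg_left (ih _ (next_bound n k) _ _ fun σ hσ => h _ hσ)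
      (binomProb_nonneg n hn p hp0 hp s hs _)

lemma trajProb_false (n : ℕ) (p : ℝ) (T : ℕ) (s : ℤ) :
    trajProb n p s T (fun _ => False) = 0 := by
  simp [trajProb]

lemma drift (n : ℕ) (hn : 0 < n) (p ε : ℝ) (hp0 : 0 ≤ p) (hp : p ≤ 1)
    (hε : ε ≤ (3 * p - 1) / 2) (s : ℤ) (hs : |s| ≤ (n : ℤ)) :
    ∑ k : Fin (n + 1), binomProb n p s k.val * (((2 * (k.val : ℤ) - (n : ℤ) : ℤ) : ℝ)) ^ 2 ≤
      n + (1 - ε) ^ 2 * (s : ℝ) ^ 2 := by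
  have hn' : (0 : ℝ) < n := by exact_mod_cast hn
  rw [binom_second]
  have hv : 4 * n * qStep n p s * (1 - qStep n p s) ≤ n := by
    nlinarith [mul_nonneg hn'.le (sq_nonneg (2 * qStep n p s - 1))]
  have hy := y_bound n hn p hp0 hp s hs
  have hm : n * (2 * qStep n p s - 1) =
      s * ((1 - p) * (3 - ((1 - p) * ((s : ℝ) / n)) ^ 2) / 2) := by
    rw [qStep_eq n hn]
    field_simp
    ring
  have hy2 : ((1 - p) * ((s : ℝ) / n)) ^ 2 ≤ 1 := (sq_le_one_iff_abs_le_one _).2 hy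
  rw [hm]
  set y := (1 - p) * ((s : ℝ) / n)
  have hy0 : 0 ≤ y ^ 2 := sq_nonneg y
  have hc0 : 0 ≤ (1 - p) * (3 - y ^ 2) / 2 := by
    have : 0 ≤ (1 - p) * (3 - y ^ 2) := mul_nonneg (by linarith) (by linarith)
    linarith
  have hc1 : (1 - p) * (3 - y ^ 2) / 2 ≤ 1 - ε := by
    nlinarith [mul_nonneg (by linarith : 0 ≤ 1 - p) hy0]
  have hc := pow_le_pow_left₀ hc0 hc1 2
  have := mul_le_mul_of_nonneg_right hc (sq_nonneg (s : ℝ))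
  nlinarith

lemma main_bound (n : ℕ) (hn : 0 < n) (p ε : ℝ) (hp0 : 0 ≤ p) (hp : p ≤ 1) (hε0 : 0 < ε)
    (hε2 : ε ≤ 1 / 2) (hε : ε ≤ (3 * p - 1) / 2) (T : ℕ) : ∀ s : ℤ, |s| ≤ (n : ℤ) →
    1 - (1 - ε) ^ T * ((s : ℝ) ^ 2 * (ε ^ 4 / n)) ≤ trajProb n p s (T + 1)
      (fun σ => ∃ τ : ℕ, τ ≤ T ∧ |(σ τ : ℝ)| ≤ Real.sqrt n / ε ^ 2) := by
  have hn' : (0 : ℝ) < n := by exact_mod_cast hn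
  have hit : ∀ (T : ℕ) (s : ℤ), |s| ≤ (n : ℤ) → |(s : ℝ)| ≤ Real.sqrt n / ε ^ 2 →
      1 - (1 - ε) ^ T * ((s : ℝ) ^ 2 * (ε ^ 4 / n)) ≤ trajProb n p s (T + 1)
      (fun σ => ∃ τ : ℕ, τ ≤ T ∧ |(σ τ : ℝ)| ≤ Real.sqrt n / ε ^ 2) := by
    intro T s hs h
    have : 0 ≤ (1 - ε) ^ T * ((s : ℝ) ^ 2 * (ε ^ 4 / n)) :=
      mul_nonneg (pow_nonneg (by linarith) _) (by positivity)
    refine le_trans (by linarith : _ ≤ (1 : ℝ)) ?_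
    rw [trajProb_succ]
    have e : ∀ k : Fin (n + 1), trajProb n p (2 * (k.val : ℤ) - (n : ℤ)) T
        (fun σ => ∃ τ : ℕ, τ ≤ T ∧ |(consState s σ τ : ℝ)| ≤ Real.sqrt n / ε ^ 2) = 1 := by
      intro k
      rw [← trajProb_true n p T (2 * (k.val : ℤ) - (n : ℤ))]
      congr 1
      funext σ
      simp only [eq_iff_iff, iff_true]
      exact ⟨0, Nat.zero_le _, h⟩
    simp only [e, mul_one]
    exact (binom_sum n p s).ge
  have big : ∀ s : ℤ, ¬ |(s : ℝ)| ≤ Real.sqrt n / ε ^ 2 → 1 ≤ (s : ℝ) ^ 2 * (ε ^ 4 / n) := by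
    intro s h
    push Not at h
    have h2 := pow_le_pow_left₀ (by positivity) h.le 2
    rw [sq_abs, div_pow, Real.sq_sqrt hn'.le, div_le_iff₀ (by positivity)] at h2
    rw [← mul_div_assoc, le_div_iff₀ hn']
    nlinarith
  induction T with
  | zero =>
    intro s hs
    by_cases h : |(s : ℝ)| ≤ Real.sqrt n / ε ^ 2
    · exact hit 0 s hs h
    · have h1 := big s h
      have h2 := trajProb_mono n hn p hp0 hp (0 + 1) s hs (fun _ => False)
        (fun σ => ∃ τ : ℕ, τ ≤ 0 ∧ |(σ τ : ℝ)| ≤ Real.sqrt n / ε ^ 2) (fun _ h => h.elim)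
      rw [trajProb_false] at h2
      simp only [pow_zero, one_mul]
      linarith
  | succ T ih =>
    intro s hs
    by_cases h : |(s : ℝ)| ≤ Real.sqrt n / ε ^ 2
    · exact hit (T + 1) s hs h
    have h1 := big s h
    rw [trajProb_succ]
    have hd := drift n hn p ε hp0 hp hε s hs
    set c := ε ^ 4 / (n : ℝ) with hc
    have hc0 : 0 < c := by positivity
    have hl : (0 : ℝ) ≤ (1 - ε) ^ T := pow_nonneg (by linarith) _
    have hstep : ∑ k : Fin (n + 1), binomProb n p s k.val *
        (1 - (1 - ε) ^ T * ((((2 * (k.val : ℤ) - (n : ℤ) : ℤ) : ℝ)) ^ 2 * c)) ≤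
        ∑ k : Fin (n + 1), binomProb n p s k.val *
        trajProb n p (2 * (k.val : ℤ) - (n : ℤ)) (T + 1)
        (fun σ => ∃ τ : ℕ, τ ≤ T + 1 ∧ |(consState s σ τ : ℝ)| ≤ Real.sqrt n / ε ^ 2) := by
      refine Finset.sum_le_sum fun k _ => ?_
      refine mul_le_mul_of_nonneg_left ?_ (binomProb_nonneg n hn p hp0 hp s hs _)
      refine (ih _ (next_bound n k)).trans ?_
      refine trajProb_mono n hn p hp0 hp _ _ (next_bound n k) _ _ ?_
      rintro σ ⟨τ, h1, h2⟩
      exact ⟨τ + 1, by omega, h2⟩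
    refine le_trans ?_ hstep
    have e : ∑ k : Fin (n + 1), binomProb n p s k.val *
        (1 - (1 - ε) ^ T * ((((2 * (k.val : ℤ) - (n : ℤ) : ℤ) : ℝ)) ^ 2 * c)) =
        1 - (1 - ε) ^ T * c * ∑ k : Fin (n + 1), binomProb n p s k.val *
          (((2 * (k.val : ℤ) - (n : ℤ) : ℤ) : ℝ)) ^ 2 := by
      conv_rhs => arg 1; rw [← binom_sum n p s]
      rw [Finset.mul_sum, ← Finset.sum_sub_distrib]
      exact Finset.sum_congr rfl fun k _ => by ring
    rw [e]
    have hnc : c * n = ε ^ 4 := by rw [hc]; field_simp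
    have key : c * (n + (1 - ε) ^ 2 * (s : ℝ) ^ 2) ≤ (1 - ε) * ((s : ℝ) ^ 2 * c) := by
      have h3 : ε ^ 4 ≤ ε ^ 4 * ((s : ℝ) ^ 2 * c) := le_mul_of_one_le_right (by positivity) h1
      have h4 : ε ^ 4 + (1 - ε) ^ 2 ≤ 1 - ε := by
        have : ε ^ 3 ≤ (1 / 2) ^ 3 := pow_le_pow_left₀ hε0.le hε2 3
        nlinarith
      have h5 := mul_le_mul_of_nonneg_right h4 (by positivity : 0 ≤ (s : ℝ) ^ 2 * c)
      nlinarith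
    have h6 := mul_le_mul_of_nonneg_left hd (mul_nonneg hl hc0.le)
    have h7 := mul_le_mul_of_nonneg_left key hl
    rw [pow_succ]
    nlinarith

/-- Let `p > 1/3`, `0 < ε < min{1−p, (3p−1)/2}`, and
`s_min = √n/ε²`. For all sufficiently large `n` and every starting bias
`s0 ≥ s_min`, with probability at least `1 − 1/n` there is a time
`τ ≤ 4(log n)/ε` such that `|s_τ| ≤ s_min`. -/
theorem bias_drops_to_sqrt_n
    (p ε : ℝ) (hp1 : 1 / 3 < p) (hp2 : p < 1) (hε0 : 0 < ε)
    (hε : ε < min (1 - p) ((3 * p - 1) / 2)) :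
    ∃ N : ℕ, ∀ n : ℕ, N ≤ n → ∀ s0 : ℤ,
      Real.sqrt n / ε ^ 2 ≤ (s0 : ℝ) → s0 ≤ (n : ℤ) →
      1 - 1 / (n : ℝ) ≤
        trajProb n p s0 ⌈4 * Real.log n / ε⌉₊
          (fun σ => ∃ τ : ℕ, (τ : ℝ) ≤ 4 * Real.log n / ε ∧
            |(σ τ : ℝ)| ≤ Real.sqrt n / ε ^ 2) := by
  have hεa : ε < 1 - p := hε.trans_le (min_le_left _ _)
  have hεb : ε < (3 * p - 1) / 2 := hε.trans_le (min_le_right _ _)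
  have hεh : ε ≤ 1 / 2 := by linarith
  refine ⟨2, fun n hn s0 hs hsn => ?_⟩
  have hn0 : 0 < n := by omega
  have hn2 : (2 : ℝ) ≤ n := by exact_mod_cast hn
  have hn' : (0 : ℝ) < n := by linarith
  have hs0 : (0 : ℝ) ≤ s0 := le_trans (by positivity) hs
  have hs0' : 0 ≤ s0 := by exact_mod_cast hs0
  have hsn' : (s0 : ℝ) ≤ n := by exact_mod_cast hsn
  have habs : |s0| ≤ (n : ℤ) := by rwa [abs_of_nonneg hs0']
  have hlog : 0 < Real.log n := Real.log_pos (by linarith)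
  have hpos : 0 < 4 * Real.log n / ε := by positivity
  obtain ⟨T, hT⟩ : ∃ T, ⌈4 * Real.log n / ε⌉₊ = T + 1 :=
    Nat.exists_eq_succ_of_ne_zero (Nat.ceil_pos.2 hpos).ne'
  have hT1 : 4 * Real.log n / ε ≤ T + 1 := by
    have := Nat.le_ceil (4 * Real.log n / ε)
    rw [hT] at this
    exact_mod_cast this
  have hb := main_bound n hn0 p ε (by linarith) hp2.le hε0 hεh hεb.le T s0 habs
  rw [hT]
  refine le_trans ?_ (hb.trans ?_)
  · have h1 : (s0 : ℝ) ^ 2 ≤ n ^ 2 := pow_le_pow_left₀ hs0 hsn' 2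
    have h2 : (s0 : ℝ) ^ 2 * (ε ^ 4 / n) ≤ n := by
      have hε4 : ε ^ 4 ≤ 1 := pow_le_one₀ hε0.le (by linarith)
      rw [← mul_div_assoc, div_le_iff₀ hn']
      nlinarith [mul_le_mul h1 hε4 (by positivity) (by positivity)]
    have h3 : (1 - ε) ^ T ≤ Real.exp 1 / n ^ 4 := by
      have h4 : (1 - ε) ^ T ≤ Real.exp (-ε) ^ T :=
        pow_le_pow_left₀ (by linarith) (Real.one_sub_le_exp_neg ε) T
      refine h4.trans ?_
      rw [← Real.exp_nat_mul]
      have h5 : (n : ℝ) ^ 4 = Real.exp (4 * Real.log n) := by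
        rw [show (4 : ℝ) * Real.log n = ((4 : ℕ) : ℝ) * Real.log n by norm_num,
          Real.exp_nat_mul, Real.exp_log hn']
      rw [h5, ← Real.exp_sub]
      apply Real.exp_le_exp.2
      rw [div_le_iff₀ hε0] at hT1
      nlinarith
    have h6 : (1 - ε) ^ T * ((s0 : ℝ) ^ 2 * (ε ^ 4 / n)) ≤ Real.exp 1 / n ^ 4 * n :=
      mul_le_mul h3 h2 (by positivity) (by positivity)
    have h7 : Real.exp 1 / (n : ℝ) ^ 4 * n ≤ 1 / n := by
      have he : Real.exp 1 ≤ 4 := by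
        have := Real.exp_one_lt_d9
        linarith
      rw [div_mul_eq_mul_div, div_le_div_iff₀ (by positivity) hn']
      have h8 : (4 : ℝ) ≤ n ^ 2 := by nlinarith
      have h9 : (0 : ℝ) ≤ n ^ 2 := by positivity
      nlinarith [mul_le_mul_of_nonneg_right (he.trans h8) h9]
    linarith
  · refine trajProb_mono n hn0 p (by linarith) hp2.le _ _ habs _ _ ?_
    rintro σ ⟨τ, h1, h2⟩
    refine ⟨τ, ?_, h2⟩
    have : τ < ⌈4 * Real.log n / ε⌉₊ := by omega
    exact (Nat.lt_ceil.1 this).le
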